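/- arXiv:2411.09919 — 3 statements merged into one kernel-verified Lean document; each statement's English description precedes it below -/
import Mathlib

section
/- Any PVM Π = {π_j} which weakly antidistinguishes a maximally contextual finite non-orthogonal set S of pure states must also strongly antidistinguish S; that is, for each ρ_i ∈ S there exists π_i ∈ Π with Tr(π_i ρ_i) = 0 and Tr(π_i ρ_j) ≠ 0 for all ρ_j ∈ S with j ≠ i. -/
open Matrix

/-- Square complex matrices of size `d`, acting on the Hilbert space `ℂ^d`. -/
abbrev Mat (d : ℕ) := Matrix (Fin d) (Fin d) ℂ

/-- An orthogonal projection. -/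
def IsProjection {d : ℕ} (p : Mat d) : Prop := p.IsHermitian ∧ p * p = p

/-- A pure state: a rank-1 orthogonal projection `|ψ⟩⟨ψ|` for a unit vector `ψ`. -/
def IsPureState {d : ℕ} (ρ : Mat d) : Prop :=
  ∃ ψ : Fin d → ℂ, star ψ ⬝ᵥ ψ = 1 ∧ ρ = vecMulVec ψ (star ψ)

/-- A PVM: a finite family of orthogonal projections, pairwise orthogonal, summing to `1`. -/
def IsPVM {d : ℕ} (P : Finset (Mat d)) : Prop :=
  (∀ p ∈ P, IsProjection p) ∧
  (∀ p ∈ P, ∀ q ∈ P, p ≠ q → p * q = 0) ∧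
  ∑ p ∈ P, p = 1

/-- A PVM given as an indexed family. -/
def IsPVMFam {d : ℕ} {ι : Type} [Fintype ι] (π : ι → Mat d) : Prop :=
  (∀ i, IsProjection (π i)) ∧ (∀ i j, i ≠ j → π i * π j = 0) ∧ ∑ i, π i = 1

/-- `P` weakly antidistinguishes `S`: every outcome of `P` excludes some state of `S`. -/
def WeaklyAntidistinguishes {d : ℕ} (P S : Finset (Mat d)) : Prop :=
  ∀ p ∈ P, ∃ ρ ∈ S, (p * ρ).trace = 0

/-- `S` is weakly antidistinguishable. -/
def IsWA {d : ℕ} (S : Finset (Mat d)) : Prop :=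
  ∃ P : Finset (Mat d), IsPVM P ∧ WeaklyAntidistinguishes P S

/-- `P` strongly antidistinguishes `S`: it weakly antidistinguishes `S` and for each state
there is an outcome excluding that state and no other. -/
def StronglyAntidistinguishes {d : ℕ} (P S : Finset (Mat d)) : Prop :=
  WeaklyAntidistinguishes P S ∧
  ∀ ρ ∈ S, ∃ p ∈ P, (p * ρ).trace = 0 ∧ ∀ ρ' ∈ S, ρ' ≠ ρ → (p * ρ').trace ≠ 0

/-- `S` is strongly antidistinguishable. -/
def IsSA {d : ℕ} (S : Finset (Mat d)) : Prop :=
  ∃ P : Finset (Mat d), IsPVM P ∧ StronglyAntidistinguishes P S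

/-- `S = {ρ_1, …, ρ_N}` is antidistinguishable: there is a PVM `{π_i}_{i=1}^N`, with one
outcome per state, such that `Tr(π_i ρ_i) = 0` for each `i`. -/
def IsA {d : ℕ} (S : Finset (Mat d)) : Prop :=
  ∃ π : Mat d → Mat d,
    (∀ ρ ∈ S, IsProjection (π ρ)) ∧
    (∀ ρ ∈ S, ∀ ρ' ∈ S, ρ ≠ ρ' → π ρ * π ρ' = 0) ∧
    (∑ ρ ∈ S, π ρ = 1) ∧
    ∀ ρ ∈ S, (π ρ * ρ).trace = 0

/-- A context: a finite set of rank-1 orthogonal projections, pairwise orthogonal,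
summing to the identity. -/
def IsContext {d : ℕ} (C : Finset (Mat d)) : Prop :=
  (∀ p ∈ C, IsPureState p) ∧
  (∀ p ∈ C, ∀ q ∈ C, p ≠ q → p * q = 0) ∧
  ∑ p ∈ C, p = 1

/-- A `{0,1}`-valued assignment on `X` such that every context drawn from `X`
has exactly one vertex assigned the value `1`. -/
def NoncontextualAssignment {d : ℕ} (X : Finset (Mat d)) (ν : Mat d → ℕ) : Prop :=
  (∀ σ ∈ X, ν σ = 0 ∨ ν σ = 1) ∧
  ∀ C ⊆ X, IsContext C → ∑ σ ∈ C, ν σ = 1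

/-- `σ` is an implied projector of `S`: a rank-1 projection orthogonal to some state of `S`. -/
def ImpliedProjector {d : ℕ} (S : Finset (Mat d)) (σ : Mat d) : Prop :=
  IsPureState σ ∧ ∃ ρ ∈ S, ρ * σ = 0

/-- `X` is a contextuality scenario generated by `S`: a finite set of rank-1 projections
with `S ⊆ X` and `X \ S ⊆ I(S)`. -/
def GeneratedScenario {d : ℕ} (S X : Finset (Mat d)) : Prop :=
  (∀ σ ∈ X, IsPureState σ) ∧ S ⊆ X ∧ ∀ σ ∈ X, σ ∉ S → ImpliedProjector S σ

/-- `S` is a contextual instance of the scenario `X`: there is no noncontextual value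
assignment on `X` assigning `1` to every state of `S`. -/
def ContextualInstance {d : ℕ} (S X : Finset (Mat d)) : Prop :=
  ¬ ∃ ν : Mat d → ℕ, NoncontextualAssignment X ν ∧ ∀ ρ ∈ S, ν ρ = 1

/-- `S` is contextual: some scenario generated by `S` has `S` as a contextual instance. -/
def IsContextualSet {d : ℕ} (S : Finset (Mat d)) : Prop :=
  ∃ X : Finset (Mat d), GeneratedScenario S X ∧ ContextualInstance S X

/-- `S` is non-orthogonal: distinct states have nonzero overlap. -/
def NonOrthogonal {d : ℕ} (S : Finset (Mat d)) : Prop :=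
  ∀ ρ ∈ S, ∀ ρ' ∈ S, ρ ≠ ρ' → (ρ * ρ').trace ≠ 0

/-- `S` is maximally contextual: `S` is contextual and no proper subset of `S` is. -/
def MaximallyContextual {d : ℕ} (S : Finset (Mat d)) : Prop :=
  IsContextualSet S ∧ ∀ S' ⊂ S, ¬ IsContextualSet S'

lemma IsPureState.isProjection {d : ℕ} {ρ : Mat d} (h : IsPureState ρ) : IsProjection ρ := by
  obtain ⟨ψ, hψ, rfl⟩ := h
  refine ⟨?_, ?_⟩
  · simp [Matrix.IsHermitian, conjTranspose_vecMulVec]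
  · rw [vecMulVec_mul_vecMulVec, hψ, one_smul]

lemma IsPureState.ne_zero {d : ℕ} {ρ : Mat d} (h : IsPureState ρ) : ρ ≠ 0 := by
  obtain ⟨ψ, hψ, rfl⟩ := h
  intro h0
  have ht := congrArg Matrix.trace h0
  rw [trace_vecMulVec, dotProduct_comm, hψ] at ht
  simp at ht

lemma IsProjection.mul_eq_zero_comm {d : ℕ} {p q : Mat d} (hp : IsProjection p)
    (hq : IsProjection q) (h : p * q = 0) : q * p = 0 := by
  have := congrArg conjTranspose h
  rwa [conjTranspose_mul, hp.1.eq, hq.1.eq, conjTranspose_zero] at this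

open scoped ComplexOrder in
lemma IsProjection.mul_eq_zero_of_trace {d : ℕ} {p q : Mat d} (hp : IsProjection p)
    (hq : IsProjection q) (h : (p * q).trace = 0) : p * q = 0 := by
  rw [← trace_mul_conjTranspose_self_eq_zero_iff, conjTranspose_mul, hp.1.eq, hq.1.eq,
    Matrix.mul_assoc, ← Matrix.mul_assoc q q p, hq.2, trace_mul_comm, Matrix.mul_assoc, hp.2,
    trace_mul_comm, h]

lemma IsProjection.one_sub {d : ℕ} {p : Mat d} (hp : IsProjection p) : IsProjection (1 - p) := by
  refine ⟨isHermitian_one.sub hp.1, ?_⟩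
  rw [mul_sub, sub_mul, sub_mul, hp.2]
  simp

lemma IsProjection.add {d : ℕ} {p q : Mat d} (hp : IsProjection p) (hq : IsProjection q)
    (h : p * q = 0) : IsProjection (p + q) := by
  refine ⟨hp.1.add hq.1, ?_⟩
  rw [mul_add, add_mul, add_mul, hp.2, hq.2, h, hp.mul_eq_zero_comm hq h]
  simp

/-- `C` is a finite set of pairwise orthogonal pure states summing to `p`. -/
def IsDecomposition {d : ℕ} (p : Mat d) (C : Finset (Mat d)) : Prop :=
  (∀ q ∈ C, IsPureState q) ∧ (∀ q ∈ C, ∀ r ∈ C, q ≠ r → q * r = 0) ∧ ∑ q ∈ C, q = p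

lemma IsDecomposition.mul_eq {d : ℕ} {p q : Mat d} {C : Finset (Mat d)}
    (hC : IsDecomposition p C) (hq : q ∈ C) : p * q = q := by
  rw [← hC.2.2, Finset.sum_mul, Finset.sum_eq_single_of_mem q hq, (hC.1 q hq).isProjection.2]
  exact fun r hr hne => hC.2.1 r hr q hq hne

/-- Pure states given by an orthonormal family of eigenvectors decompose a projection. -/
lemma IsProjection.exists_decomposition {d : ℕ} {p : Mat d} (hp : IsProjection p) :
    ∃ C, IsDecomposition p C := by
  classical
  let u : Fin d → Fin d → ℂ := fun i => (hp.1.eigenvectorBasis i).ofLp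
  let q : Fin d → Mat d := fun i => vecMulVec (u i) (star (u i))
  have hu : ∀ i j, star (u i) ⬝ᵥ u j = if i = j then 1 else 0 := by
    intro i j
    rw [← orthonormal_iff_ite.mp hp.1.eigenvectorBasis.orthonormal i j,
      EuclideanSpace.inner_eq_star_dotProduct, dotProduct_comm]
  have hpu : ∀ i, p *ᵥ u i = (hp.1.eigenvalues i : ℂ) • u i := fun i => by
    simpa using hp.1.mulVec_eigenvectorBasis i
  have hpure : ∀ i, IsPureState (q i) := fun i => ⟨u i, by simp [hu], rfl⟩
  have horth : ∀ i j, i ≠ j → q i * q j = 0 := by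
    intro i j hij
    simp [q, vecMulVec_mul_vecMulVec, hu, hij]
  have hinj : Function.Injective q := by
    intro i j hij
    by_contra hne
    have := horth i j hne
    rw [← hij, (hpure i).isProjection.2] at this
    exact (hpure i).ne_zero this
  have hone : ∑ i, q i = 1 := by
    have hU := Unitary.coe_mul_star_self hp.1.eigenvectorUnitary
    rw [← hU]
    ext a b
    simp [q, u, Matrix.sum_apply, vecMulVec_apply, Matrix.mul_apply, star_apply]
  have hpq : ∀ i, p * q i = (hp.1.eigenvalues i : ℂ) • q i := by
    intro i
    rw [mul_vecMulVec, hpu, smul_vecMulVec]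
  have hev : ∀ i, (hp.1.eigenvalues i : ℂ) = 0 ∨ (hp.1.eigenvalues i : ℂ) = 1 := by
    intro i
    have h : p * (p * q i) = p * q i := by rw [← Matrix.mul_assoc, hp.2]
    rw [hpq, Matrix.mul_smul, hpq, smul_smul] at h
    have h' := smul_left_injective ℂ (hpure i).ne_zero h
    exact IsIdempotentElem.iff_eq_zero_or_one.mp h'
  refine ⟨(Finset.univ.filter fun i => (hp.1.eigenvalues i : ℂ) = 1).image q, ?_, ?_, ?_⟩
  · simp only [Finset.mem_image]
    rintro _ ⟨i, -, rfl⟩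
    exact hpure i
  · simp only [Finset.mem_image]
    rintro _ ⟨i, -, rfl⟩ _ ⟨j, -, rfl⟩ hne
    exact horth i j fun h => hne (h ▸ rfl)
  · rw [Finset.sum_image hinj.injOn, Finset.sum_filter]
    calc _ = ∑ i, p * q i := Finset.sum_congr rfl fun i _ => by
            rw [hpq]
            rcases hev i with h | h <;> simp [h]
      _ = p := by rw [← Finset.mul_sum, hone, mul_one]

/-- A PVM refines to a context. -/
lemma IsPVM.exists_context {d : ℕ} {P : Finset (Mat d)} (hP : IsPVM P) :
    ∃ C, IsContext C ∧ ∀ σ ∈ C, ∃ p ∈ P, p * σ = σ := by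
  classical
  have hdec : ∀ p, ∃ C, p ∈ P → IsDecomposition p C := fun p => by
    by_cases hp : p ∈ P
    · obtain ⟨C, hC⟩ := (hP.1 p hp).exists_decomposition
      exact ⟨C, fun _ => hC⟩
    · exact ⟨∅, fun h => absurd h hp⟩
  choose C hC using hdec
  have horth : ∀ p ∈ P, ∀ p' ∈ P, p ≠ p' → ∀ q ∈ C p, ∀ r ∈ C p', q * r = 0 := by
    intro p hp p' hp' hne q hq r hr
    have h : r * p = 0 := by
      apply (hP.1 p hp).mul_eq_zero_comm ((hC p' hp').1 r hr).isProjection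
      rw [← (hC p' hp').mul_eq hr, ← Matrix.mul_assoc, hP.2.1 p hp p' hp' hne, zero_mul]
    apply ((hC p' hp').1 r hr).isProjection.mul_eq_zero_comm ((hC p hp).1 q hq).isProjection
    rw [← (hC p hp).mul_eq hq, ← Matrix.mul_assoc, h, zero_mul]
  refine ⟨P.biUnion C, ⟨?_, ?_, ?_⟩, ?_⟩
  · simp only [Finset.mem_biUnion]
    rintro q ⟨p, hp, hq⟩
    exact (hC p hp).1 q hq
  · simp only [Finset.mem_biUnion]
    rintro q ⟨p, hp, hq⟩ r ⟨p', hp', hr⟩ hne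
    by_cases h : p = p'
    · subst h
      exact (hC p hp).2.1 q hq r hr hne
    · exact horth p hp p' hp' h q hq r hr
  · rw [Finset.sum_biUnion, ← hP.2.2]
    · exact Finset.sum_congr rfl fun p hp => (hC p hp).2.2
    · intro p hp p' hp' hne
      refine Finset.disjoint_left.mpr fun q hq hq' => ((hC p hp).1 q hq).ne_zero ?_
      rw [← ((hC p hp).1 q hq).isProjection.2]
      exact horth p hp p' hp' hne q hq q hq'
  · simp only [Finset.mem_biUnion]
    rintro q ⟨p, hp, hq⟩
    exact ⟨p, hp, (hC p hp).mul_eq hq⟩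

/-- Two orthogonal pure states belong to a common context. -/
lemma IsPureState.exists_context {d : ℕ} {ρ σ : Mat d} (hρ : IsPureState ρ) (hσ : IsPureState σ)
    (h : ρ * σ = 0) : ∃ D, IsContext D ∧ ρ ∈ D ∧ σ ∈ D := by
  classical
  have hτ : IsProjection (ρ + σ) := hρ.isProjection.add hσ.isProjection h
  have h' := hρ.isProjection.mul_eq_zero_comm hσ.isProjection h
  obtain ⟨E, hE⟩ := hτ.one_sub.exists_decomposition
  have hE₁ : ∀ q ∈ E, ρ * q = 0 := fun q hq => by
    rw [← hE.mul_eq hq, ← Matrix.mul_assoc, mul_sub, mul_add, hρ.isProjection.2, h]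
    simp
  have hE₂ : ∀ q ∈ E, σ * q = 0 := fun q hq => by
    rw [← hE.mul_eq hq, ← Matrix.mul_assoc, mul_sub, mul_add, hσ.isProjection.2, h']
    simp
  have hσE : σ ∉ E := fun hm => hσ.ne_zero (hσ.isProjection.2 ▸ hE₂ σ hm)
  have hρE : ρ ∉ insert σ E := by
    rw [Finset.mem_insert, not_or]
    refine ⟨fun he => hρ.ne_zero ?_, fun hm => hρ.ne_zero (hρ.isProjection.2 ▸ hE₁ ρ hm)⟩
    rw [← he, hρ.isProjection.2] at h
    exact h
  refine ⟨insert ρ (insert σ E), ⟨?_, ?_, ?_⟩, by simp, by simp⟩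
  · simp only [Finset.mem_insert]
    rintro q (rfl | rfl | hq)
    exacts [hρ, hσ, hE.1 q hq]
  · simp only [Finset.mem_insert]
    rintro q (rfl | rfl | hq) r (rfl | rfl | hr) hne
    · exact absurd rfl hne
    · exact h
    · exact hE₁ r hr
    · exact h'
    · exact absurd rfl hne
    · exact hE₂ r hr
    · exact hρ.isProjection.mul_eq_zero_comm (hE.1 q hq).isProjection (hE₁ q hq)
    · exact hσ.isProjection.mul_eq_zero_comm (hE.1 q hq).isProjection (hE₂ q hq)
    · exact hE.2.1 q hq r hr hne
  · rw [Finset.sum_insert hρE, Finset.sum_insert hσE, hE.2.2]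
    abel

/-- A weakly antidistinguishable set of pure states is contextual. -/
lemma IsWA.isContextualSet {d : ℕ} {S : Finset (Mat d)} (hpure : ∀ ρ ∈ S, IsPureState ρ)
    (h : IsWA S) : IsContextualSet S := by
  classical
  obtain ⟨P, hP, hWA⟩ := h
  obtain ⟨C, hC, hCP⟩ := hP.exists_context
  have hex : ∀ σ, ∃ ρ, ∃ D, σ ∈ C → ρ ∈ S ∧ ρ * σ = 0 ∧ IsContext D ∧ ρ ∈ D ∧ σ ∈ D := by
    intro σ
    by_cases hσ : σ ∈ C
    · obtain ⟨p, hp, hpσ⟩ := hCP σ hσ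
      obtain ⟨ρ, hρ, ht⟩ := hWA p hp
      have hpr := (hpure ρ hρ).isProjection
      have hρσ : ρ * σ = 0 := by
        rw [← hpσ, ← Matrix.mul_assoc, (hP.1 p hp).mul_eq_zero_comm hpr
          ((hP.1 p hp).mul_eq_zero_of_trace hpr ht), zero_mul]
      obtain ⟨D, hD⟩ := (hpure ρ hρ).exists_context (hC.1 σ hσ) hρσ
      exact ⟨ρ, D, fun _ => ⟨hρ, hρσ, hD⟩⟩
    · exact ⟨0, ∅, fun h => absurd h hσ⟩
  choose ρ D hD using hex
  refine ⟨S ∪ (C ∪ C.biUnion D), ⟨?_, Finset.subset_union_left, ?_⟩, ?_⟩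
  · simp only [Finset.mem_union, Finset.mem_biUnion]
    rintro τ (hτ | hτ | ⟨σ, hσ, hτ⟩)
    · exact hpure τ hτ
    · exact hC.1 τ hτ
    · exact (hD σ hσ).2.2.1.1 τ hτ
  · simp only [Finset.mem_union, Finset.mem_biUnion]
    rintro τ (hτ | hτ | ⟨σ, hσ, hτ⟩) hS
    · exact absurd hτ hS
    · exact ⟨hC.1 τ hτ, ρ τ, (hD τ hτ).1, (hD τ hτ).2.1⟩
    · obtain ⟨hρS, -, hctx, hρD, -⟩ := hD σ hσ
      exact ⟨hctx.1 τ hτ, ρ σ, hρS, hctx.2.1 _ hρD τ hτ fun he => hS (he ▸ hρS)⟩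
  · rintro ⟨ν, ⟨-, hν⟩, hνS⟩
    have hzero : ∀ σ ∈ C, ν σ = 0 := by
      intro σ hσ
      obtain ⟨hρS, hρσ, hctx, hρD, hσD⟩ := hD σ hσ
      have hsum := hν (D σ) (fun τ hτ => by
        simp only [Finset.mem_union, Finset.mem_biUnion]
        exact Or.inr (Or.inr ⟨σ, hσ, hτ⟩)) hctx
      have hne : σ ≠ ρ σ := fun he => by
        rw [← he, (hC.1 σ hσ).isProjection.2] at hρσ
        exact (hC.1 σ hσ).ne_zero hρσ
      rw [← Finset.add_sum_erase _ _ hρD, hνS _ hρS, Nat.add_eq_left] at hsum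
      exact Finset.sum_eq_zero_iff.mp hsum σ (Finset.mem_erase.mpr ⟨hne, hσD⟩)
    have hsum := hν C (Finset.subset_union_left.trans Finset.subset_union_right) hC
    rw [Finset.sum_eq_zero hzero] at hsum
    exact zero_ne_one hsum

/-- Any PVM which weakly antidistinguishes a maximally contextual
non-orthogonal set of pure states must also strongly antidistinguish it. -/
theorem statement_1 {d : ℕ} (S P : Finset (Mat d))
    (hpure : ∀ ρ ∈ S, IsPureState ρ) (hnon : NonOrthogonal S)
    (hmax : MaximallyContextual S)
    (hPVM : IsPVM P) (hWA : WeaklyAntidistinguishes P S) :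
    StronglyAntidistinguishes P S := by
  classical
  refine ⟨hWA, fun ρ hρ => ?_⟩
  by_contra! hcon
  refine hmax.2 (S.erase ρ) (Finset.erase_ssubset hρ)
    (IsWA.isContextualSet (fun τ hτ => hpure τ (Finset.mem_of_mem_erase hτ)) ⟨P, hPVM, ?_⟩)
  intro p hp
  obtain ⟨τ, hτ, ht⟩ := hWA p hp
  by_cases hne : τ = ρ
  · obtain ⟨τ', hτ', hne', ht'⟩ := hcon p hp (hne ▸ ht)
    exact ⟨τ', Finset.mem_erase.mpr ⟨hne', hτ'⟩, ht'⟩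
  · exact ⟨τ, Finset.mem_erase.mpr ⟨hne, hτ⟩, ht⟩
end

section
/- If a finite non-orthogonal set S of pure states on a finite-dimensional complex Hilbert space is weakly antidistinguishable by a rank-1 PVM Π, then the set X = (⋃_i C_i) ∪ S, where for each π_i ∈ Π one chooses a context C_i containing π_i and a state ρ_{π_i} ∈ S orthogonal to π_i, is a scenario generated by S for which S is a contextual instance; hence S is contextual. -/
open Matrix

/-- The square of a pure state does not vanish. -/
lemma IsPureState.mul_self_ne_zero {d : ℕ} {ρ : Mat d} (h : IsPureState ρ) : ρ * ρ ≠ 0 := by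
  obtain ⟨ψ, hψ, rfl⟩ := h
  intro h0
  have ht := congrArg trace h0
  simp [vecMulVec_mul_vecMulVec, trace_vecMulVec, hψ, dotProduct_comm ψ] at ht

/-- If a finite non-orthogonal set `S` of pure states is weakly
antidistinguished by a rank-1 PVM `P`, then `X = (⋃_{p ∈ P} C_p) ∪ S` — where for each
`p ∈ P` one chooses a context `C_p` containing `p` together with a state `ρof p ∈ S`
orthogonal to `p` — is a scenario generated by `S` of which `S` is a contextual
instance; hence `S` is contextual. -/
theorem statement_16 {d : ℕ} (S P : Finset (Mat d))
    (hpure : ∀ ρ ∈ S, IsPureState ρ) (hnon : NonOrthogonal S)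
    (hPVM : IsPVM P) (hPrank1 : ∀ p ∈ P, IsPureState p)
    (hWA : WeaklyAntidistinguishes P S)
    (Ctx : Mat d → Finset (Mat d)) (ρof : Mat d → Mat d)
    (hCtx : ∀ p ∈ P, IsContext (Ctx p) ∧ p ∈ Ctx p ∧ ρof p ∈ Ctx p ∧
      ρof p ∈ S ∧ ρof p * p = 0) :
    GeneratedScenario S (P.biUnion Ctx ∪ S) ∧
    ContextualInstance S (P.biUnion Ctx ∪ S) ∧
    IsContextualSet S := by
  have hgen : GeneratedScenario S (P.biUnion Ctx ∪ S) := by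
    refine ⟨fun σ hσ => ?_, Finset.subset_union_right, fun σ hσ hσS => ?_⟩
    · rcases Finset.mem_union.1 hσ with h | h
      · obtain ⟨p, hp, hσp⟩ := Finset.mem_biUnion.1 h
        exact (hCtx p hp).1.1 σ hσp
      · exact hpure σ h
    · obtain ⟨p, hp, hσp⟩ :=
        Finset.mem_biUnion.1 ((Finset.mem_union.1 hσ).resolve_right hσS)
      obtain ⟨hC, -, hρC, hρS, -⟩ := hCtx p hp
      exact ⟨hC.1 σ hσp, ρof p, hρS, hC.2.1 _ hρC σ hσp fun h => hσS (h ▸ hρS)⟩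
  have hinst : ContextualInstance S (P.biUnion Ctx ∪ S) := by
    rintro ⟨ν, ⟨-, hν⟩, hνS⟩
    have hzero : ∀ p ∈ P, ν p = 0 := by
      intro p hp
      obtain ⟨hC, hpC, hρC, hρS, horth⟩ := hCtx p hp
      have hne : ρof p ≠ p := fun h => (hPrank1 p hp).mul_self_ne_zero (by rwa [h] at horth)
      have hsum := hν (Ctx p)
        ((Finset.subset_biUnion_of_mem Ctx hp).trans Finset.subset_union_left) hC
      have hle := Finset.add_le_sum (f := ν) (fun _ _ => Nat.zero_le _) hρC hpC hne
      have := hνS _ hρS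
      omega
    have hPsub : P ⊆ P.biUnion Ctx ∪ S := fun p hp =>
      Finset.mem_union_left _ (Finset.mem_biUnion.2 ⟨p, hp, (hCtx p hp).2.1⟩)
    have hsum := hν P hPsub ⟨hPrank1, hPVM.2.1, hPVM.2.2⟩
    rw [Finset.sum_eq_zero hzero] at hsum
    exact zero_ne_one hsum
  exact ⟨hgen, hinst, _, hgen, hinst⟩
end

section
/- If a finite non-orthogonal set of three pure states S = {ψ_1, ψ_2, ψ_3} with pairwise squared overlaps δ_1 = |⟨ψ_1|ψ_2⟩|², δ_2 = |⟨ψ_1|ψ_3⟩|², δ_3 = |⟨ψ_2|ψ_3⟩|² is antidistinguishable, then δ_1 + δ_2 + δ_3 < 1 and (δ_1 + δ_2 + δ_3 − 1)² ≥ 4 δ_1 δ_2 δ_3. -/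
open Matrix

open scoped ComplexOrder in
theorem star_dotProduct_self_re_nonneg {n : Type*} [Fintype n] (u : n → ℂ) :
    0 ≤ (star u ⬝ᵥ u).re :=
  (Complex.le_def.mp (dotProduct_star_self_nonneg u)).1

theorem normSq_star_dotProduct_le {n : Type*} [Fintype n] (u v : n → ℂ) :
    Complex.normSq (star u ⬝ᵥ v) ≤ (star u ⬝ᵥ u).re * (star v ⬝ᵥ v).re := by
  have h := inner_mul_inner_self_le (𝕜 := ℂ) (WithLp.toLp 2 u) (WithLp.toLp 2 v)
  have hn : ‖inner ℂ (WithLp.toLp 2 v) (WithLp.toLp 2 u)‖ =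
      ‖inner ℂ (WithLp.toLp 2 u) (WithLp.toLp 2 v)‖ := norm_inner_symm _ _
  rw [hn, ← sq, ← Complex.normSq_eq_norm_sq] at h
  simpa only [EuclideanSpace.inner_eq_star_dotProduct, dotProduct_comm, RCLike.re_to_complex]
    using h

theorem IsProjection.star_dotProduct_mulVec {d : ℕ} {p : Mat d} (hp : IsProjection p)
    (u v : Fin d → ℂ) : star u ⬝ᵥ (p *ᵥ v) = star (p *ᵥ u) ⬝ᵥ (p *ᵥ v) := by
  rw [star_mulVec, ← dotProduct_mulVec, mulVec_mulVec, hp.1.eq, hp.2]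

open scoped ComplexOrder in
theorem IsProjection.mulVec_eq_zero_of_trace {d : ℕ} {p : Mat d} (hp : IsProjection p)
    {u : Fin d → ℂ} (h : (p * vecMulVec u (star u)).trace = 0) : p *ᵥ u = 0 := by
  rw [mul_vecMulVec, trace_vecMulVec, dotProduct_comm, hp.star_dotProduct_mulVec] at h
  exact dotProduct_star_self_eq_zero.mp h

theorem IsPVMFam.star_dotProduct_eq_sum {d : ℕ} {ι : Type} [Fintype ι] {π : ι → Mat d}
    (hπ : IsPVMFam π) (u v : Fin d → ℂ) :
    star u ⬝ᵥ v = ∑ i, star (π i *ᵥ u) ⬝ᵥ (π i *ᵥ v) := by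
  simp_rw [← (hπ.1 _).star_dotProduct_mulVec]
  rw [← dotProduct_sum, ← sum_mulVec, hπ.2.2, one_mulVec]

/-- Overlaps bounded by products of complementary weights satisfy the two inequalities of
Caves, Fuchs and Schack. -/
theorem overlap_bounds {x x' y y' z z' δ₁ δ₂ δ₃ : ℝ} (hx' : 0 ≤ x') (hy' : 0 ≤ y')
    (hz' : 0 ≤ z')
    (ex : x + x' = 1) (ey : y + y' = 1) (ez : z + z' = 1)
    (p₁ : 0 < δ₁) (p₂ : 0 < δ₂) (p₃ : 0 < δ₃)
    (b₁ : δ₁ ≤ x' * y) (b₂ : δ₂ ≤ x * z') (b₃ : δ₃ ≤ y' * z) :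
    δ₁ + δ₂ + δ₃ < 1 ∧ (δ₁ + δ₂ + δ₃ - 1) ^ 2 ≥ 4 * δ₁ * δ₂ * δ₃ := by
  have hy0 : 0 < y := pos_of_mul_pos_right (p₁.trans_le b₁) hx'
  have hx0 : 0 < x := pos_of_mul_pos_left (p₂.trans_le b₂) hz'
  have hz0 : 0 < z := pos_of_mul_pos_right (p₃.trans_le b₃) hy'
  have hA : 0 < x * y * z := by positivity
  have hB : 0 ≤ x' * y' * z' := by positivity
  have hS : x * y * z + x' * y' * z' ≤ 1 - (δ₁ + δ₂ + δ₃) := by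
    have : x * y * z + x' * y' * z' = 1 - (x' * y + x * z' + y' * z) := by
      obtain rfl : x' = 1 - x := by linarith
      obtain rfl : y' = 1 - y := by linarith
      obtain rfl : z' = 1 - z := by linarith
      ring
    linarith
  have hP : δ₁ * δ₂ * δ₃ ≤ (x * y * z) * (x' * y' * z') := by
    calc δ₁ * δ₂ * δ₃ ≤ (x' * y) * (x * z') * (y' * z) := by gcongr
      _ = _ := by ring
  have hQ : (x * y * z + x' * y' * z') ^ 2 ≤ (1 - (δ₁ + δ₂ + δ₃)) ^ 2 := by gcongr
  exact ⟨by linarith, by nlinarith [sq_nonneg (x * y * z - x' * y' * z')]⟩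

/-- If a non-orthogonal set of three pure states `{ψ₁, ψ₂, ψ₃}` with
pairwise squared overlaps `δ₁, δ₂, δ₃` is antidistinguishable, then
`δ₁ + δ₂ + δ₃ < 1` and `(δ₁ + δ₂ + δ₃ − 1)² ≥ 4 δ₁ δ₂ δ₃`. -/
theorem statement_17 {d : ℕ} (ψ₁ ψ₂ ψ₃ : Fin d → ℂ)
    (h1 : star ψ₁ ⬝ᵥ ψ₁ = 1) (h2 : star ψ₂ ⬝ᵥ ψ₂ = 1) (h3 : star ψ₃ ⬝ᵥ ψ₃ = 1)
    (hδ1 : Complex.normSq (star ψ₁ ⬝ᵥ ψ₂) ≠ 0)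
    (hδ2 : Complex.normSq (star ψ₁ ⬝ᵥ ψ₃) ≠ 0)
    (hδ3 : Complex.normSq (star ψ₂ ⬝ᵥ ψ₃) ≠ 0)
    (hA : ∃ π : Fin 3 → Mat d, IsPVMFam π ∧
      (π 0 * vecMulVec ψ₁ (star ψ₁)).trace = 0 ∧
      (π 1 * vecMulVec ψ₂ (star ψ₂)).trace = 0 ∧
      (π 2 * vecMulVec ψ₃ (star ψ₃)).trace = 0) :
    Complex.normSq (star ψ₁ ⬝ᵥ ψ₂) + Complex.normSq (star ψ₁ ⬝ᵥ ψ₃) +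
        Complex.normSq (star ψ₂ ⬝ᵥ ψ₃) < 1 ∧
      (Complex.normSq (star ψ₁ ⬝ᵥ ψ₂) + Complex.normSq (star ψ₁ ⬝ᵥ ψ₃) +
          Complex.normSq (star ψ₂ ⬝ᵥ ψ₃) - 1) ^ 2 ≥
        4 * Complex.normSq (star ψ₁ ⬝ᵥ ψ₂) * Complex.normSq (star ψ₁ ⬝ᵥ ψ₃) *
          Complex.normSq (star ψ₂ ⬝ᵥ ψ₃) := by
  obtain ⟨π, hπ, t₁, t₂, t₃⟩ := hA
  have z₁ := (hπ.1 0).mulVec_eq_zero_of_trace t₁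
  have z₂ := (hπ.1 1).mulVec_eq_zero_of_trace t₂
  have z₃ := (hπ.1 2).mulVec_eq_zero_of_trace t₃
  have e₁ : star ψ₁ ⬝ᵥ ψ₂ = star (π 2 *ᵥ ψ₁) ⬝ᵥ (π 2 *ᵥ ψ₂) := by
    rw [hπ.star_dotProduct_eq_sum]; simp [Fin.sum_univ_three, z₁, z₂]
  have e₂ : star ψ₁ ⬝ᵥ ψ₃ = star (π 1 *ᵥ ψ₁) ⬝ᵥ (π 1 *ᵥ ψ₃) := by
    rw [hπ.star_dotProduct_eq_sum]; simp [Fin.sum_univ_three, z₁, z₃]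
  have e₃ : star ψ₂ ⬝ᵥ ψ₃ = star (π 0 *ᵥ ψ₂) ⬝ᵥ (π 0 *ᵥ ψ₃) := by
    rw [hπ.star_dotProduct_eq_sum]; simp [Fin.sum_univ_three, z₂, z₃]
  rw [hπ.star_dotProduct_eq_sum] at h1 h2 h3
  simp only [Fin.sum_univ_three, z₁, z₂, z₃, dotProduct_zero, zero_add, add_zero] at h1 h2 h3
  exact overlap_bounds
    (star_dotProduct_self_re_nonneg (π 2 *ᵥ ψ₁)) (star_dotProduct_self_re_nonneg (π 0 *ᵥ ψ₂))
    (star_dotProduct_self_re_nonneg (π 1 *ᵥ ψ₃))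
    (congrArg Complex.re h1) (congrArg Complex.re ((add_comm _ _).trans h2))
    (congrArg Complex.re h3)
    ((Complex.normSq_nonneg _).lt_of_ne' hδ1) ((Complex.normSq_nonneg _).lt_of_ne' hδ2)
    ((Complex.normSq_nonneg _).lt_of_ne' hδ3)
    (e₁ ▸ normSq_star_dotProduct_le _ _) (e₂ ▸ normSq_star_dotProduct_le _ _)
    (e₃ ▸ normSq_star_dotProduct_le _ _)
end
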